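/- Tweedie's formula (core of Theorem 1(b), measure form). For every σ > 0, every probability measure μ on E, and every z ∈ E: the Gaussian-smoothed density satisfies q(z) > 0, q is differentiable at z, the posterior mean m(z) is well defined, and m(z) = z + σ² • (q(z))⁻¹ • ∇q(z); equivalently, m(z) = z + σ² • ∇(fun u => Real.log (q u))(z). -/

import Mathlib

open MeasureTheory

/-- Isotropic Gaussian density with standard deviation `σ` on `EuclideanSpace ℝ (Fin n)`. -/
noncomputable def gaussDens (n : ℕ) (σ : ℝ) (u : EuclideanSpace ℝ (Fin n)) : ℝ :=
  (2 * Real.pi * σ ^ 2) ^ (-(n : ℝ) / 2) * Real.exp (-‖u‖ ^ 2 / (2 * σ ^ 2))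

/-- Gaussian-smoothed density `q z = ∫ φ_σ (z - x) ∂μ x`. -/
noncomputable def smoothedDens (n : ℕ) (σ : ℝ)
    (μ : Measure (EuclideanSpace ℝ (Fin n))) (z : EuclideanSpace ℝ (Fin n)) : ℝ :=
  ∫ x, gaussDens n σ (z - x) ∂μ

/-- Posterior mean `m z = (q z)⁻¹ • ∫ x • φ_σ (z - x) ∂μ x`. -/
noncomputable def postMean (n : ℕ) (σ : ℝ)
    (μ : Measure (EuclideanSpace ℝ (Fin n))) (z : EuclideanSpace ℝ (Fin n)) :
    EuclideanSpace ℝ (Fin n) :=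
  (smoothedDens n σ μ z)⁻¹ • ∫ x, gaussDens n σ (z - x) • x ∂μ

theorem gaussDens_pos (n : ℕ) (σ : ℝ) (hσ : 0 < σ) (u : EuclideanSpace ℝ (Fin n)) :
    0 < gaussDens n σ u := by
  unfold gaussDens
  have := Real.pi_pos
  positivity

theorem gaussDens_continuous (n : ℕ) (σ : ℝ) : Continuous (gaussDens n σ) := by
  unfold gaussDens
  fun_prop

theorem gaussDens_le (n : ℕ) (σ : ℝ) (hσ : 0 < σ) (u : EuclideanSpace ℝ (Fin n)) :
    gaussDens n σ u ≤ (2 * Real.pi * σ ^ 2) ^ (-(n : ℝ) / 2) := by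
  unfold gaussDens
  have := Real.pi_pos
  refine mul_le_of_le_one_right (by positivity) (Real.exp_le_one_iff.2 ?_)
  rw [neg_div]
  have : 0 ≤ ‖u‖ ^ 2 / (2 * σ ^ 2) := by positivity
  linarith

theorem gaussDens_mul_norm_le (n : ℕ) (σ : ℝ) (hσ : 0 < σ) (u : EuclideanSpace ℝ (Fin n)) :
    gaussDens n σ u * ‖u‖ ≤ (2 * Real.pi * σ ^ 2) ^ (-(n : ℝ) / 2) * (1 + 2 * σ ^ 2) := by
  unfold gaussDens
  have := Real.pi_pos
  rw [mul_assoc]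
  refine mul_le_mul_of_nonneg_left ?_ (by positivity)
  rw [neg_div, Real.exp_neg]
  set s := ‖u‖ ^ 2 / (2 * σ ^ 2) with hs
  have hs0 : 0 ≤ s := by positivity
  have h1 : s + 1 ≤ Real.exp s := Real.add_one_le_exp s
  have h2 : ‖u‖ ^ 2 = 2 * σ ^ 2 * s := by rw [hs]; field_simp
  rw [inv_mul_le_iff₀ (Real.exp_pos s)]
  have h3 : ‖u‖ ≤ (s + 1) * (1 + 2 * σ ^ 2) := by
    nlinarith [sq_nonneg (‖u‖ - 1), sq_nonneg ‖u‖, sq_nonneg σ]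
  exact h3.trans (mul_le_mul_of_nonneg_right h1 (by positivity))

theorem gaussDens_hasFDerivAt (n : ℕ) (σ : ℝ) (hσ : 0 < σ) (u : EuclideanSpace ℝ (Fin n)) :
    HasFDerivAt (gaussDens n σ) (innerSL ℝ (-(gaussDens n σ u / σ ^ 2) • u)) u := by
  have h := ((((hasStrictFDerivAt_norm_sq u).hasFDerivAt.neg.mul_const
    ((2 * σ ^ 2)⁻¹)).exp).const_mul ((2 * Real.pi * σ ^ 2) ^ (-(n : ℝ) / 2)))
  refine h.congr_fderiv ?_
  ext v
  simp [gaussDens]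
  field_simp

theorem gaussDens_integrable (n : ℕ) (σ : ℝ) (hσ : 0 < σ)
    (μ : Measure (EuclideanSpace ℝ (Fin n))) [IsProbabilityMeasure μ]
    (z : EuclideanSpace ℝ (Fin n)) : Integrable (fun x => gaussDens n σ (z - x)) μ := by
  refine Integrable.of_bound (C := (2 * Real.pi * σ ^ 2) ^ (-(n : ℝ) / 2))
    ((gaussDens_continuous n σ).comp (by fun_prop)).aestronglyMeasurable
    (Filter.Eventually.of_forall fun x => ?_)
  rw [Real.norm_of_nonneg (gaussDens_pos n σ hσ _).le]
  exact gaussDens_le n σ hσ _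

theorem gaussDens_smul_integrable (n : ℕ) (σ : ℝ) (hσ : 0 < σ)
    (μ : Measure (EuclideanSpace ℝ (Fin n))) [IsProbabilityMeasure μ]
    (z : EuclideanSpace ℝ (Fin n)) :
    Integrable (fun x => gaussDens n σ (z - x) • (z - x)) μ := by
  have hc := gaussDens_continuous n σ
  refine Integrable.of_bound
    (C := (2 * Real.pi * σ ^ 2) ^ (-(n : ℝ) / 2) * (1 + 2 * σ ^ 2))
    (Continuous.aestronglyMeasurable (by fun_prop))
    (Filter.Eventually.of_forall fun x => ?_)
  rw [norm_smul, Real.norm_of_nonneg (gaussDens_pos n σ hσ _).le]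
  exact gaussDens_mul_norm_le n σ hσ _

theorem smoothedDens_hasGradientAt (n : ℕ) (σ : ℝ) (hσ : 0 < σ)
    (μ : Measure (EuclideanSpace ℝ (Fin n))) [IsProbabilityMeasure μ]
    (z : EuclideanSpace ℝ (Fin n)) :
    HasGradientAt (smoothedDens n σ μ)
      (-(σ ^ 2)⁻¹ • ∫ x, gaussDens n σ (z - x) • (z - x) ∂μ) z := by
  have hc := gaussDens_continuous n σ
  have key := hasFDerivAt_integral_of_dominated_of_fderiv_le (𝕜 := ℝ) (μ := μ) (x₀ := z)
    (s := Set.univ)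
    (F := fun w x => gaussDens n σ (w - x))
    (F' := fun w x => innerSL ℝ (-(gaussDens n σ (w - x) / σ ^ 2) • (w - x)))
    (bound := fun _ => (σ ^ 2)⁻¹ *
      ((2 * Real.pi * σ ^ 2) ^ (-(n : ℝ) / 2) * (1 + 2 * σ ^ 2)))
    Filter.univ_mem
    (Filter.Eventually.of_forall fun w => (gaussDens_integrable n σ hσ μ w).1)
    (gaussDens_integrable n σ hσ μ z)
    (Continuous.aestronglyMeasurable (by fun_prop))
    (Filter.Eventually.of_forall fun x w _ => by
      rw [innerSL_apply_norm, norm_smul, norm_neg, norm_div,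
        Real.norm_of_nonneg (gaussDens_pos n σ hσ _).le,
        Real.norm_of_nonneg (sq_nonneg σ), div_eq_inv_mul, mul_assoc]
      exact mul_le_mul_of_nonneg_left (gaussDens_mul_norm_le n σ hσ _) (by positivity))
    (integrable_const _)
    (Filter.Eventually.of_forall fun x w _ => by
      have := (gaussDens_hasFDerivAt n σ hσ (w - x)).comp w ((hasFDerivAt_id w).sub_const x)
      exact this)
  rw [hasGradientAt_iff_hasFDerivAt]
  refine key.congr_fderiv ?_
  have e : ∀ x, -(gaussDens n σ (z - x) / σ ^ 2) • (z - x)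
      = -(σ ^ 2)⁻¹ • (gaussDens n σ (z - x) • (z - x)) := fun x => by
    rw [smul_smul]; congr 1; ring
  simp_rw [e]
  refine (ContinuousLinearMap.integral_comp_comm (innerSL ℝ)
    ((gaussDens_smul_integrable n σ hσ μ z).smul (-(σ ^ 2)⁻¹))).trans ?_
  simp only [Pi.smul_apply]
  rw [integral_smul]
  rfl

/-- Tweedie's formula (measure form). -/
theorem tweedie_formula (n : ℕ) (hn : 0 < n) (σ : ℝ) (hσ : 0 < σ)
    (μ : Measure (EuclideanSpace ℝ (Fin n))) [IsProbabilityMeasure μ]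
    (z : EuclideanSpace ℝ (Fin n)) :
    0 < smoothedDens n σ μ z ∧
    DifferentiableAt ℝ (smoothedDens n σ μ) z ∧
    Integrable (fun x => gaussDens n σ (z - x) • x) μ ∧
    postMean n σ μ z
      = z + σ ^ 2 • ((smoothedDens n σ μ z)⁻¹ • gradient (smoothedDens n σ μ) z) ∧
    postMean n σ μ z
      = z + σ ^ 2 • gradient (fun u => Real.log (smoothedDens n σ μ u)) z := by
  have hg := smoothedDens_hasGradientAt n σ hσ μ z
  have hi := gaussDens_integrable n σ hσ μ z
  have hi2 := gaussDens_smul_integrable n σ hσ μ z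
  have hpos : 0 < smoothedDens n σ μ z := by
    unfold smoothedDens
    rw [integral_pos_iff_support_of_nonneg (fun x => (gaussDens_pos n σ hσ _).le) hi]
    have : Function.support (fun x => gaussDens n σ (z - x)) = Set.univ :=
      Set.eq_univ_of_forall fun x => (gaussDens_pos n σ hσ _).ne'
    simp [this]
  have e : (fun x => gaussDens n σ (z - x) • x)
      = fun x => gaussDens n σ (z - x) • z - gaussDens n σ (z - x) • (z - x) := by
    funext x; rw [← smul_sub, sub_sub_cancel]
  have hint : Integrable (fun x => gaussDens n σ (z - x) • x) μ := by
    rw [e]; exact (hi.smul_const z).sub hi2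
  have h4 : postMean n σ μ z
      = z + σ ^ 2 • ((smoothedDens n σ μ z)⁻¹ • gradient (smoothedDens n σ μ) z) := by
    rw [hg.gradient, postMean, e, integral_sub (hi.smul_const z) hi2, integral_smul_const,
      smul_sub, smul_smul]
    change ((smoothedDens n σ μ z)⁻¹ * smoothedDens n σ μ z) • z - _ = _
    rw [inv_mul_cancel₀ hpos.ne', one_smul, sub_eq_add_neg, smul_smul, smul_smul, ← neg_smul]
    congr 2
    field_simp
  refine ⟨hpos, hg.differentiableAt, hint, h4, ?_⟩
  have hl : HasGradientAt (fun u => Real.log (smoothedDens n σ μ u))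
      ((smoothedDens n σ μ z)⁻¹ • gradient (smoothedDens n σ μ) z) z := by
    rw [hasGradientAt_iff_hasFDerivAt, hg.gradient]
    refine (hg.hasFDerivAt.log hpos.ne').congr_fderiv ?_
    simp
  rw [hl.gradient, h4]
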